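/- arXiv:1702.04839 — 3 statements merged into one kernel-verified Lean document; each statement's English description precedes it below -/
import Mathlib

section
/- Let Y be a Delone set in ℝ with packing radius r > 0 and covering radius R > 0. Let ψ : ℕ → [0,∞) be any function and let α be a real number with |α| > 1. If the series ∑_{n=1}^∞ ψ(n) converges, then for Lebesgue-almost every x ∈ ℝ there are only finitely many pairs (n, y) ∈ ℕ × Y satisfying |α^n x − y| ≤ ψ(n). -/
open MeasureTheory Set

/-- On a set whose points are at mutual distance at least `2 * r`, the map
`y ↦ ⌊y / (2 * r)⌋` is injective. -/
lemma injOn_floor_div_of_separated {Y : Set ℝ} {r : ℝ} (hr : 0 < r)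
    (hpack : ∀ y ∈ Y, ∀ y' ∈ Y, y ≠ y' → 2 * r ≤ |y - y'|) :
    InjOn (fun y : ℝ ↦ ⌊y / (2 * r)⌋) Y := by
  intro y hy y' hy' h
  by_contra hne
  have h1 := hpack y hy y' hy' hne
  have h2 := Int.abs_sub_lt_one_of_floor_eq_floor h
  rw [← sub_div, abs_div, abs_of_pos (by positivity : 0 < 2 * r), div_lt_one (by positivity)] at h2
  linarith

/-- A separated set of reals has at most `M / r + 2` points in `[-M, M]`. -/
lemma exists_finset_card_le_of_separated {Y : Set ℝ} {r M : ℝ} (hr : 0 < r) (hM : 0 ≤ M)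
    (hpack : ∀ y ∈ Y, ∀ y' ∈ Y, y ≠ y' → 2 * r ≤ |y - y'|) :
    ∃ s : Finset ℝ, (∀ y, y ∈ s ↔ y ∈ Y ∧ |y| ≤ M) ∧ (s.card : ℝ) ≤ M / r + 2 := by
  classical
  set f : ℝ → ℤ := fun y ↦ ⌊y / (2 * r)⌋ with hf
  set t : Finset ℤ := Finset.Icc ⌊-M / (2 * r)⌋ ⌊M / (2 * r)⌋ with ht
  have hinj : InjOn f {y | y ∈ Y ∧ |y| ≤ M} :=
    (injOn_floor_div_of_separated hr hpack).mono fun y hy ↦ hy.1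
  have hmaps : MapsTo f {y | y ∈ Y ∧ |y| ≤ M} (t : Set ℤ) := by
    rintro y ⟨-, hy⟩
    obtain ⟨h1, h2⟩ := abs_le.mp hy
    simp only [ht, hf, Finset.coe_Icc, mem_Icc]
    constructor <;> gcongr
  have hfin : {y | y ∈ Y ∧ |y| ≤ M}.Finite := .of_injOn hmaps hinj t.finite_toSet
  refine ⟨hfin.toFinset, by simp, ?_⟩
  have hcard : hfin.toFinset.card ≤ t.card :=
    Finset.card_le_card_of_injOn f (by simpa using hmaps) (by simpa using hinj)
  have hle : ⌊-M / (2 * r)⌋ ≤ ⌊M / (2 * r)⌋ := by gcongr; linarith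
  have htcard : (t.card : ℝ) = ⌊M / (2 * r)⌋ + 1 - ⌊-M / (2 * r)⌋ := by
    have : (t.card : ℤ) = ⌊M / (2 * r)⌋ + 1 - ⌊-M / (2 * r)⌋ := by
      rw [ht, Int.card_Icc]; omega
    exact_mod_cast this
  have h1 := Int.floor_le (M / (2 * r))
  have h2 := Int.lt_floor_add_one (-M / (2 * r))
  have h3 : M / (2 * r) - -M / (2 * r) = M / r := by field_simp; ring
  have h4 : (hfin.toFinset.card : ℝ) ≤ t.card := by exact_mod_cast hcard
  linarith

/-- The points of `[-K, K]` that multiplication by `a` brings within `ε` of a separated set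
have measure at most a constant multiple of `ε`, uniformly in `|a| ≥ 1`. -/
lemma volume_mul_near_separated_le {Y : Set ℝ} {r K ε a : ℝ} (hr : 0 < r) (hK : 0 ≤ K)
    (hε : 0 ≤ ε) (ha : 1 ≤ |a|)
    (hpack : ∀ y ∈ Y, ∀ y' ∈ Y, y ≠ y' → 2 * r ≤ |y - y'|) :
    volume {x : ℝ | |x| ≤ K ∧ ∃ y ∈ Y, |a * x - y| ≤ ε} ≤
      ENNReal.ofReal (2 * ((K + ε) / r + 2) * ε) := by
  have ha0 : 0 < |a| := by linarith
  have hane : a ≠ 0 := abs_pos.mp ha0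
  obtain ⟨s, hs, hcard⟩ := exists_finset_card_le_of_separated (M := |a| * (K + ε)) hr
    (by positivity) hpack
  have hsub : {x : ℝ | |x| ≤ K ∧ ∃ y ∈ Y, |a * x - y| ≤ ε} ⊆
      ⋃ y ∈ s, Metric.closedBall (y / a) (ε / |a|) := by
    rintro x ⟨hx, y, hy, hxy⟩
    refine mem_biUnion (x := y) ((hs y).2 ⟨hy, ?_⟩) ?_
    · have h1 : |y| ≤ |a * x| + |a * x - y| := by
        have := abs_sub_abs_le_abs_sub y (a * x)
        rw [abs_sub_comm] at this
        linarith
      rw [abs_mul] at h1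
      nlinarith [mul_le_mul_of_nonneg_left hx ha0.le, mul_le_mul_of_nonneg_right ha hε]
    · rw [Metric.mem_closedBall, Real.dist_eq, le_div_iff₀ ha0, ← abs_mul,
        show (x - y / a) * a = a * x - y by field_simp]
      exact hxy
  calc volume {x : ℝ | |x| ≤ K ∧ ∃ y ∈ Y, |a * x - y| ≤ ε}
      ≤ ∑ y ∈ s, volume (Metric.closedBall (y / a) (ε / |a|)) :=
        (measure_mono hsub).trans (measure_biUnion_finset_le _ _)
    _ = ENNReal.ofReal (s.card * (2 * (ε / |a|))) := by
        simp only [Real.volume_closedBall, Finset.sum_const, nsmul_eq_mul]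
        rw [ENNReal.ofReal_mul (Nat.cast_nonneg _), ENNReal.ofReal_natCast]
    _ ≤ ENNReal.ofReal (2 * ((K + ε) / r + 2) * ε) := by
        refine ENNReal.ofReal_le_ofReal ?_
        have h : (s.card : ℝ) ≤ |a| * ((K + ε) / r + 2) := by
          rw [mul_add, ← mul_div_assoc]
          linarith
        calc (s.card : ℝ) * (2 * (ε / |a|))
            ≤ |a| * ((K + ε) / r + 2) * (2 * (ε / |a|)) := by gcongr
          _ = 2 * ((K + ε) / r + 2) * ε := by field_simp

/-- Convergence half of the main theorem: if `Y` is a Delone set in `ℝ` with packing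
radius `r` and covering radius `R`, `ψ : ℕ → [0,∞)` and `|α| > 1` with `∑ ψ(n) < ∞`,
then for almost every `x` there are only finitely many pairs `(n, y) ∈ ℕ × Y` with
`|α^n x - y| ≤ ψ n`. -/
theorem delone_khintchine_convergence
    (Y : Set ℝ) (r R : ℝ) (hr : 0 < r) (hR : 0 < R)
    (hpack : ∀ y ∈ Y, ∀ y' ∈ Y, y ≠ y' → 2 * r ≤ |y - y'|)
    (hcov : ∀ x : ℝ, ∃ y ∈ Y, |x - y| ≤ R)
    (ψ : ℕ → ℝ) (hψ : ∀ n, 0 ≤ ψ n)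
    (α : ℝ) (hα : 1 < |α|)
    (hconv : Summable ψ) :
    ∀ᵐ x : ℝ, {p : ℕ × ℝ | p.2 ∈ Y ∧ |α ^ p.1 * x - p.2| ≤ ψ p.1}.Finite := by
  have hae : ∀ᵐ x : ℝ, ∀ K : ℕ, ∀ᶠ n in Filter.atTop,
      x ∉ {x : ℝ | |x| ≤ K ∧ ∃ y ∈ Y, |α ^ n * x - y| ≤ ψ n} := by
    refine ae_all_iff.2 fun K ↦ ae_eventually_notMem (ne_top_of_le_ne_top
      (hconv.mul_left (2 * ((K + ∑' n, ψ n) / r + 2))).tsum_ofReal_ne_top ?_)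
    refine ENNReal.tsum_le_tsum fun n ↦ (volume_mul_near_separated_le hr K.cast_nonneg (hψ n)
      (by rw [abs_pow]; exact one_le_pow₀ hα.le) hpack).trans (ENNReal.ofReal_le_ofReal ?_)
    have := hconv.le_tsum n fun m _ ↦ hψ m
    have := hψ n
    gcongr
  filter_upwards [hae] with x hx
  obtain ⟨K, hK⟩ := exists_nat_ge |x|
  obtain ⟨N, hN⟩ := Filter.eventually_atTop.1 (hx K)
  have hfin : ∀ n, {y | y ∈ Y ∧ |y| ≤ |α ^ n * x| + ψ n}.Finite := fun n ↦ by
    obtain ⟨s, hs, -⟩ := exists_finset_card_le_of_separated (M := |α ^ n * x| + ψ n) hr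
      (add_nonneg (abs_nonneg _) (hψ n)) hpack
    exact s.finite_toSet.subset fun y hy ↦ (hs y).2 hy
  refine ((finite_lt_nat N).biUnion fun n _ ↦ (hfin n).image (Prod.mk n)).subset ?_
  rintro ⟨n, y⟩ ⟨hy, hxy⟩
  have hn : n < N := by
    by_contra! hle
    exact hN n hle ⟨hK, y, hy, hxy⟩
  refine mem_biUnion (x := n) hn ⟨y, ⟨hy, ?_⟩, rfl⟩
  have := abs_sub_abs_le_abs_sub y (α ^ n * x)
  rw [abs_sub_comm] at this
  dsimp only at hxy
  linarith
end

section
/- Let Y be a Delone set in ℝ with packing radius r > 0 and covering radius R > 0. Let ψ : ℕ → [0,∞) be any function and let α be a real number with |α| > 1. If the series ∑_{n=1}^∞ ψ(n) diverges, then for Lebesgue-almost every x ∈ ℝ there are infinitely many pairs (n, y) ∈ ℕ × Y satisfying |α^n x − y| ≤ ψ(n). -/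
open MeasureTheory Set

/-- A second-moment lower bound for the measure of a finite union, in linearized form. -/
theorem sum_measureReal_le_of_pairwise_inter {X ι : Type*} [MeasurableSpace X] (μ : Measure X)
    [IsFiniteMeasure μ] (F : Finset ι) (A : ι → Set X) (hA : ∀ i, MeasurableSet (A i))
    {t : ℝ} (ht : 0 < t) :
    ∑ i ∈ F, μ.real (A i) ≤
      t / 2 * ∑ i ∈ F, ∑ j ∈ F, μ.real (A i ∩ A j) + 1 / (2 * t) * μ.real (⋃ i ∈ F, A i) := by
  have hU : MeasurableSet (⋃ i ∈ F, A i) := F.measurableSet_biUnion fun i _ => hA i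
  have hint : ∀ {B : Set X}, MeasurableSet B → Integrable (B.indicator (1 : X → ℝ)) μ :=
    fun hB => (integrable_const (1 : ℝ)).indicator hB
  have hint2 : Integrable (fun x => ∑ i ∈ F, ∑ j ∈ F, (A i ∩ A j).indicator (1 : X → ℝ) x) μ :=
    integrable_finsetSum _ fun i _ => integrable_finsetSum _ fun j _ =>
      hint ((hA i).inter (hA j))
  have h1 : ∑ i ∈ F, μ.real (A i) = ∫ x, ∑ i ∈ F, (A i).indicator (1 : X → ℝ) x ∂μ := by
    rw [integral_finsetSum _ fun i _ => hint (hA i)]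
    exact Finset.sum_congr rfl fun i _ => (integral_indicator_one (hA i)).symm
  have h2 : ∑ i ∈ F, ∑ j ∈ F, μ.real (A i ∩ A j) =
      ∫ x, ∑ i ∈ F, ∑ j ∈ F, (A i ∩ A j).indicator (1 : X → ℝ) x ∂μ := by
    rw [integral_finsetSum _ fun i _ => integrable_finsetSum _ fun j _ =>
      hint ((hA i).inter (hA j))]
    refine Finset.sum_congr rfl fun i _ => ?_
    rw [integral_finsetSum _ fun j _ => hint ((hA i).inter (hA j))]
    exact Finset.sum_congr rfl fun j _ => (integral_indicator_one ((hA i).inter (hA j))).symm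
  rw [h1, h2, ← integral_indicator_one hU, ← integral_const_mul, ← integral_const_mul,
    ← integral_add (hint2.const_mul _) ((hint hU).const_mul _)]
  refine integral_mono (integrable_finsetSum _ fun i _ => hint (hA i))
    ((hint2.const_mul _).add ((hint hU).const_mul _)) fun x => ?_
  have hsq : ∑ i ∈ F, ∑ j ∈ F, (A i ∩ A j).indicator (1 : X → ℝ) x =
      (∑ i ∈ F, (A i).indicator (1 : X → ℝ) x) ^ 2 := by
    rw [sq, Finset.sum_mul_sum]
    refine Finset.sum_congr rfl fun i _ => Finset.sum_congr rfl fun j _ => ?_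
    rw [Set.inter_indicator_one, Pi.mul_apply]
  simp only [hsq]
  by_cases hx : x ∈ ⋃ i ∈ F, A i
  · rw [Set.indicator_of_mem hx, Pi.one_apply]
    set f := ∑ i ∈ F, (A i).indicator (1 : X → ℝ) x
    have : t / 2 * f ^ 2 + 1 / (2 * t) * 1 - f = (t * f - 1) ^ 2 / (2 * t) := by
      field_simp
      ring
    have : 0 ≤ (t * f - 1) ^ 2 / (2 * t) := by positivity
    linarith
  · have h0 : ∑ i ∈ F, (A i).indicator (1 : X → ℝ) x = 0 := by
      refine Finset.sum_eq_zero fun i hi => Set.indicator_of_notMem (fun h => hx ?_) _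
      exact mem_biUnion (s := (F : Set ι)) hi h
    rw [h0, Set.indicator_of_notMem hx]
    simp

theorem volume_real_preimage_mul_left_inter_closedBall {a : ℝ} (ha : a ≠ 0) (S : Set ℝ)
    (x ρ : ℝ) :
    volume.real ((a * ·) ⁻¹' S ∩ Metric.closedBall x ρ) =
      |a|⁻¹ * volume.real (S ∩ Metric.closedBall (a * x) (|a| * ρ)) := by
  have h : (a * ·) ⁻¹' S ∩ Metric.closedBall x ρ =
      (a * ·) ⁻¹' (S ∩ Metric.closedBall (a * x) (|a| * ρ)) := by
    ext z
    simp only [mem_inter_iff, mem_preimage, Metric.mem_closedBall, Real.dist_eq]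
    rw [← mul_sub, abs_mul, mul_le_mul_iff_right₀ (abs_pos.2 ha)]
  rw [h, measureReal_def, Real.volume_preimage_mul_left ha, ENNReal.toReal_mul,
    ENNReal.toReal_ofReal (abs_nonneg _), abs_inv, measureReal_def]

section Delone

variable {Y : Set ℝ} {r R : ℝ}

theorem pairwiseDisjoint_ball_of_separated
    (hpack : ∀ y ∈ Y, ∀ y' ∈ Y, y ≠ y' → 2 * r ≤ |y - y'|) {s : ℝ} (hs : s ≤ r) :
    Y.PairwiseDisjoint fun y => Metric.ball y s := by
  intro y hy y' hy' hne
  refine Metric.ball_disjoint_ball ?_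
  rw [Real.dist_eq]
  linarith [hpack y hy y' hy' hne]

theorem card_mul_le_of_separated (hr : 0 < r)
    (hpack : ∀ y ∈ Y, ∀ y' ∈ Y, y ≠ y' → 2 * r ≤ |y - y'|) {c ρ : ℝ} (hρ : 0 ≤ ρ)
    {F : Finset ℝ} (hF : (F : Set ℝ) ⊆ Y ∩ Metric.closedBall c ρ) : F.card * r ≤ ρ + r := by
  have h1 := measureReal_biUnion_finset (μ := volume) (s := F) (f := fun y => Metric.ball y r)
    ((pairwiseDisjoint_ball_of_separated hpack le_rfl).subset fun y hy => (hF hy).1)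
    (fun _ _ => measurableSet_ball) (fun _ _ => measure_ball_lt_top.ne)
  have h2 : volume.real (⋃ y ∈ F, Metric.ball y r) ≤
      volume.real (Metric.closedBall c (ρ + r)) := by
    refine measureReal_mono (iUnion₂_subset fun y hy => ?_) measure_closedBall_lt_top.ne
    refine Metric.ball_subset_closedBall.trans (Metric.closedBall_subset_closedBall' ?_)
    have := Metric.mem_closedBall.1 (hF hy).2
    linarith
  simp only [Real.volume_real_ball hr.le, Finset.sum_const, nsmul_eq_mul] at h1
  rw [h1, Real.volume_real_closedBall (by linarith)] at h2
  linarith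

theorem exists_finset_of_separated (hr : 0 < r)
    (hpack : ∀ y ∈ Y, ∀ y' ∈ Y, y ≠ y' → 2 * r ≤ |y - y'|) (c : ℝ) {ρ : ℝ} (hρ : 0 ≤ ρ) :
    ∃ F : Finset ℝ, (F : Set ℝ) = Y ∩ Metric.closedBall c ρ ∧ F.card * r ≤ ρ + r := by
  have hfin : (Y ∩ Metric.closedBall c ρ).Finite := by
    by_contra hinf
    obtain ⟨n, hn⟩ := exists_nat_gt ((ρ + r) / r)
    obtain ⟨F, hF, hcard⟩ := Set.Infinite.exists_subset_card_eq hinf n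
    have h := card_mul_le_of_separated hr hpack hρ hF
    rw [hcard] at h
    rw [div_lt_iff₀ hr] at hn
    linarith
  refine ⟨hfin.toFinset, hfin.coe_toFinset, card_mul_le_of_separated hr hpack (c := c) hρ ?_⟩
  rw [hfin.coe_toFinset]

/-- Reduction of a measure estimate for a thickening to one for balls around its centres. -/
theorem volume_real_thickening_inter_le (hr : 0 < r)
    (hpack : ∀ y ∈ Y, ∀ y' ∈ Y, y ≠ y' → 2 * r ≤ |y - y'|) {s : ℝ} (hs : s ≤ r)
    (P : Set ℝ) {c ρ K : ℝ} (hρ : 0 ≤ ρ) (hK : 0 ≤ K)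
    (hP : ∀ y, volume.real (P ∩ Metric.closedBall y s) ≤ K) :
    volume.real (Metric.thickening s Y ∩ P ∩ Metric.closedBall c ρ) ≤ (ρ / r + 2) * K := by
  obtain ⟨F, hF, hcard⟩ := exists_finset_of_separated hr hpack c (add_nonneg hρ hr.le)
  have hsub : Metric.thickening s Y ∩ P ∩ Metric.closedBall c ρ ⊆
      ⋃ y ∈ F, P ∩ Metric.closedBall y s := by
    rintro z ⟨⟨hz, hzP⟩, hzc⟩
    obtain ⟨y, hy, hzy⟩ := Metric.mem_thickening_iff.1 hz
    have hyF : y ∈ (F : Set ℝ) := by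
      rw [hF]
      refine ⟨hy, ?_⟩
      rw [Metric.mem_closedBall] at hzc ⊢
      have := dist_triangle_left y c z
      linarith
    exact mem_biUnion hyF ⟨hzP, hzy.le⟩
  have hfin : volume (⋃ y ∈ F, P ∩ Metric.closedBall y s) ≠ ⊤ := by
    refine ((measure_biUnion_lt_top F.finite_toSet) fun y _ => ?_).ne
    exact (measure_mono inter_subset_right).trans_lt measure_closedBall_lt_top
  calc volume.real (Metric.thickening s Y ∩ P ∩ Metric.closedBall c ρ)
      ≤ volume.real (⋃ y ∈ F, P ∩ Metric.closedBall y s) := measureReal_mono hsub hfin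
    _ ≤ ∑ y ∈ F, volume.real (P ∩ Metric.closedBall y s) := measureReal_biUnion_finset_le _ _
    _ ≤ ∑ _y ∈ F, K := Finset.sum_le_sum fun y _ => hP y
    _ = F.card * K := by rw [Finset.sum_const, nsmul_eq_mul]
    _ ≤ (ρ / r + 2) * K := by
        refine mul_le_mul_of_nonneg_right ?_ hK
        rw [← mul_le_mul_iff_left₀ hr]
        have : (ρ / r + 2) * r = ρ + 2 * r := by field_simp
        linarith

theorem volume_real_thickening_le (hr : 0 < r)
    (hpack : ∀ y ∈ Y, ∀ y' ∈ Y, y ≠ y' → 2 * r ≤ |y - y'|) {s : ℝ} (hs0 : 0 ≤ s) (hs : s ≤ r)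
    (c : ℝ) {ρ : ℝ} (hρ : 0 ≤ ρ) :
    volume.real (Metric.thickening s Y ∩ Metric.closedBall c ρ) ≤ (ρ / r + 2) * (2 * s) := by
  have h := volume_real_thickening_inter_le hr hpack hs univ (c := c) (K := 2 * s) hρ
    (by positivity) fun y => by rw [univ_inter, Real.volume_real_closedBall hs0]
  rwa [inter_univ] at h

theorem le_volume_real_thickening (hr : 0 < r) (hR : 0 < R)
    (hpack : ∀ y ∈ Y, ∀ y' ∈ Y, y ≠ y' → 2 * r ≤ |y - y'|)
    (hcov : ∀ x : ℝ, ∃ y ∈ Y, |x - y| ≤ R) {s : ℝ} (hs0 : 0 ≤ s) (hs : s ≤ r)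
    (c : ℝ) {ρ : ℝ} (hρ : 2 * (R + r) ≤ ρ) :
    s * ρ / R ≤ volume.real (Metric.thickening s Y ∩ Metric.closedBall c ρ) := by
  obtain ⟨F, hF, -⟩ := exists_finset_of_separated hr hpack c
    (show (0 : ℝ) ≤ ρ / 2 + R by linarith)
  have hFcov : ρ ≤ F.card * (2 * R) := by
    have h1 : volume.real (Metric.closedBall c (ρ / 2)) ≤
        volume.real (⋃ y ∈ F, Metric.closedBall y R) := by
      refine measureReal_mono (fun z hz => ?_) ?_
      · obtain ⟨y, hy, hzy⟩ := hcov z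
        have hyF : y ∈ (F : Set ℝ) := by
          rw [hF]
          refine ⟨hy, ?_⟩
          rw [Metric.mem_closedBall] at hz ⊢
          have := dist_triangle_left y c z
          rw [← Real.dist_eq] at hzy
          linarith
        exact mem_biUnion hyF hzy
      · exact ((measure_biUnion_lt_top F.finite_toSet) fun y _ => measure_closedBall_lt_top).ne
    have h2 := measureReal_biUnion_finset_le (μ := volume) F fun y => Metric.closedBall y R
    simp only [Real.volume_real_closedBall hR.le, Finset.sum_const, nsmul_eq_mul] at h2
    rw [Real.volume_real_closedBall (by linarith)] at h1
    linarith
  have hsum := measureReal_biUnion_finset (μ := volume) (s := F)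
    (f := fun y => Metric.ball y s)
    ((pairwiseDisjoint_ball_of_separated hpack hs).subset fun y hy => (hF ▸ hy).1)
    (fun _ _ => measurableSet_ball) (fun _ _ => measure_ball_lt_top.ne)
  simp only [Real.volume_real_ball hs0, Finset.sum_const, nsmul_eq_mul] at hsum
  have hsub : volume.real (⋃ y ∈ F, Metric.ball y s) ≤
      volume.real (Metric.thickening s Y ∩ Metric.closedBall c ρ) := by
    refine measureReal_mono (iUnion₂_subset fun y hy => ?_)
      ((measure_mono inter_subset_right).trans_lt measure_closedBall_lt_top).ne
    have hyF : y ∈ Y ∩ Metric.closedBall c (ρ / 2 + R) := hF ▸ hy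
    refine subset_inter (Metric.ball_subset_thickening hyF.1 s) ?_
    refine Metric.ball_subset_closedBall.trans (Metric.closedBall_subset_closedBall' ?_)
    have := Metric.mem_closedBall.1 hyF.2
    linarith
  rw [hsum] at hsub
  refine le_trans ?_ hsub
  rw [div_le_iff₀ hR]
  nlinarith

theorem le_volume_real_preimage_thickening (hr : 0 < r) (hR : 0 < R)
    (hpack : ∀ y ∈ Y, ∀ y' ∈ Y, y ≠ y' → 2 * r ≤ |y - y'|)
    (hcov : ∀ x : ℝ, ∃ y ∈ Y, |x - y| ≤ R) {s : ℝ} (hs0 : 0 ≤ s) (hs : s ≤ r)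
    {a : ℝ} (ha : a ≠ 0) (x : ℝ) {ρ : ℝ} (hρ : 2 * (R + r) ≤ |a| * ρ) :
    s * ρ / R ≤
      volume.real ((a * ·) ⁻¹' Metric.thickening s Y ∩ Metric.closedBall x ρ) := by
  have ha' := abs_pos.2 ha
  rw [volume_real_preimage_mul_left_inter_closedBall ha, le_inv_mul_iff₀ ha']
  refine le_trans (le_of_eq ?_) (le_volume_real_thickening hr hR hpack hcov hs0 hs _ hρ)
  ring

theorem volume_real_preimage_thickening_inter_le (hr : 0 < r)
    (hpack : ∀ y ∈ Y, ∀ y' ∈ Y, y ≠ y' → 2 * r ≤ |y - y'|) {s s' : ℝ} (hs0 : 0 ≤ s)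
    (hs : s ≤ r) (hs0' : 0 ≤ s') (hs' : s' ≤ r) {a b : ℝ} (ha : a ≠ 0) (hb : b ≠ 0) (x : ℝ)
    {ρ : ℝ} (hρ0 : 0 ≤ ρ) (hρ : 2 * r ≤ |a| * ρ) :
    volume.real (((a * ·) ⁻¹' Metric.thickening s Y ∩ (b * a * ·) ⁻¹' Metric.thickening s' Y) ∩
      Metric.closedBall x ρ) ≤ 4 * ρ / r * (s' * s / r + 2 * |b|⁻¹ * s') := by
  have ha' := abs_pos.2 ha
  have hb' := abs_pos.2 hb
  have heq : (a * ·) ⁻¹' Metric.thickening s Y ∩ (b * a * ·) ⁻¹' Metric.thickening s' Y =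
      (a * ·) ⁻¹' (Metric.thickening s Y ∩ (b * ·) ⁻¹' Metric.thickening s' Y) := by
    ext z
    simp only [mem_inter_iff, mem_preimage, mul_assoc]
  rw [heq, volume_real_preimage_mul_left_inter_closedBall ha, inv_mul_le_iff₀ ha']
  set K := 2 * (s' * s / r + 2 * |b|⁻¹ * s') with hKdef
  have hK : 0 ≤ K := by positivity
  have h := volume_real_thickening_inter_le hr hpack hs ((b * ·) ⁻¹' Metric.thickening s' Y)
    (c := a * x) (ρ := |a| * ρ) (K := K) (by positivity) hK fun y => by
      rw [volume_real_preimage_mul_left_inter_closedBall hb, inv_mul_le_iff₀ hb']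
      refine (volume_real_thickening_le hr hpack hs0' hs' _ (by positivity)).trans (le_of_eq ?_)
      rw [hKdef]
      field_simp
  refine h.trans ?_
  have h2 : |a| * ρ / r + 2 ≤ 2 * (|a| * ρ / r) := by
    have : 2 ≤ |a| * ρ / r := by rwa [le_div_iff₀ hr]
    linarith
  refine (mul_le_mul_of_nonneg_right h2 hK).trans (le_of_eq ?_)
  rw [hKdef]
  ring

end Delone

/-- The geometric kernel `q ^ (n - m)` on `m ≤ n` has row sums at most `(1 - q)⁻¹`. -/
theorem sum_ite_pow_sub_le {q : ℝ} (hq0 : 0 ≤ q) (hq1 : q < 1) (F : Finset ℕ) (n : ℕ) :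
    ∑ m ∈ F, (if m ≤ n then q ^ (n - m) else 0) ≤ (1 - q)⁻¹ := by
  rw [← Finset.sum_filter]
  calc ∑ m ∈ F with m ≤ n, q ^ (n - m) ≤ ∑ m ∈ Finset.range (n + 1), q ^ (n - m) := by
        refine Finset.sum_le_sum_of_subset_of_nonneg (fun m hm => ?_) fun _ _ _ => by positivity
        have := (Finset.mem_filter.1 hm).2
        exact Finset.mem_range.2 (by lia)
    _ = ∑ k ∈ Finset.range (n + 1), q ^ k := by
        rw [← Finset.sum_range_reflect]
        refine Finset.sum_congr rfl fun m hm => ?_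
        have := Finset.mem_range.1 hm
        congr 1
        lia
    _ ≤ ∑' k, q ^ k := (summable_geometric_of_lt_one hq0 hq1).sum_le_tsum _
        fun _ _ => by positivity
    _ = (1 - q)⁻¹ := tsum_geometric_of_lt_one hq0 hq1

theorem not_summable_min {ψ : ℕ → ℝ} (hdiv : ¬ Summable ψ) {r : ℝ}
    (hr : 0 < r) : ¬ Summable fun n => min (ψ n) r := by
  intro h
  refine hdiv (h.congr_atTop ?_)
  filter_upwards [h.tendsto_atTop_zero.eventually_lt_const hr] with n hn
  exact min_eq_left ((min_lt_iff.1 hn).resolve_right (lt_irrefl r)).le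

theorem exists_one_le_sum_Ico {φ : ℕ → ℝ} (hφ : ∀ n, 0 ≤ φ n) (hdiv : ¬ Summable φ) (M : ℕ) :
    ∃ N, 1 ≤ ∑ n ∈ Finset.Ico M N, φ n := by
  have h := (not_summable_iff_tendsto_nat_atTop_of_nonneg hφ).1 hdiv
  obtain ⟨N, hN, hMN⟩ := ((h.eventually_ge_atTop (1 + ∑ n ∈ Finset.range M, φ n)).and
    (Filter.eventually_ge_atTop M)).exists
  refine ⟨N, ?_⟩
  rw [Finset.sum_Ico_eq_sub _ hMN]
  linarith

section Dilations

variable {Y : Set ℝ} {r R : ℝ} {φ : ℕ → ℝ} {α : ℝ}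

theorem sum_sum_volume_real_inter_le (hr : 0 < r)
    (hpack : ∀ y ∈ Y, ∀ y' ∈ Y, y ≠ y' → 2 * r ≤ |y - y'|) (hφ : ∀ n, 0 ≤ φ n)
    (hφr : ∀ n, φ n ≤ r) (hα : 1 < |α|) (x : ℝ) {ρ : ℝ} (hρ : 0 ≤ ρ) {F : Finset ℕ}
    (hF : ∀ n ∈ F, 2 * r ≤ |α ^ n| * ρ) (hS : 1 ≤ ∑ n ∈ F, φ n) :
    ∑ m ∈ F, ∑ n ∈ F, volume.real (((α ^ m * ·) ⁻¹' Metric.thickening (φ m) Y ∩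
      (α ^ n * ·) ⁻¹' Metric.thickening (φ n) Y) ∩ Metric.closedBall x ρ) ≤
      4 * ρ / r * (1 / r + 4 * (1 - |α|⁻¹)⁻¹) * (∑ n ∈ F, φ n) ^ 2 := by
  have hα0 : α ≠ 0 := by
    rintro rfl
    norm_num at hα
  set q := |α|⁻¹ with hq
  have hq0 : 0 ≤ q := by positivity
  have hq1 : q < 1 := inv_lt_one_of_one_lt₀ hα
  set k : ℕ → ℕ → ℝ := fun n m => if m ≤ n then q ^ (n - m) else 0 with hk
  have hk0 : ∀ n m, 0 ≤ k n m := fun n m => by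
    simp only [hk]
    split_ifs <;> positivity
  set S := ∑ n ∈ F, φ n with hSdef
  have hle : ∀ m ∈ F, ∀ n, m ≤ n →
      volume.real (((α ^ m * ·) ⁻¹' Metric.thickening (φ m) Y ∩
        (α ^ n * ·) ⁻¹' Metric.thickening (φ n) Y) ∩ Metric.closedBall x ρ) ≤
      4 * ρ / r * (φ n * φ m / r + 2 * (φ n * k n m)) := by
    intro m hm n hmn
    have h := volume_real_preimage_thickening_inter_le hr hpack (hφ m) (hφr m) (hφ n) (hφr n)
      (pow_ne_zero m hα0) (pow_ne_zero (n - m) hα0) x hρ (hF m hm)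
    rw [← pow_add, Nat.sub_add_cancel hmn] at h
    refine h.trans (le_of_eq ?_)
    simp only [hk, if_pos hmn, hq, abs_pow, inv_pow]
    ring
  have hpair : ∀ m ∈ F, ∀ n ∈ F,
      volume.real (((α ^ m * ·) ⁻¹' Metric.thickening (φ m) Y ∩
        (α ^ n * ·) ⁻¹' Metric.thickening (φ n) Y) ∩ Metric.closedBall x ρ) ≤
      4 * ρ / r * (φ m * φ n / r + 2 * (φ n * k n m) + 2 * (φ m * k m n)) := by
    intro m hm n hn
    have h1 := mul_nonneg (hφ n) (hk0 n m)
    have h2 := mul_nonneg (hφ m) (hk0 m n)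
    rcases le_total m n with hmn | hmn
    · refine (hle m hm n hmn).trans (mul_le_mul_of_nonneg_left ?_ (by positivity))
      rw [mul_comm (φ n) (φ m)]
      linarith
    · rw [inter_comm ((α ^ m * ·) ⁻¹' _)]
      refine (hle n hn m hmn).trans (mul_le_mul_of_nonneg_left ?_ (by positivity))
      linarith
  have hrow : ∑ n ∈ F, ∑ m ∈ F, φ n * k n m ≤ S * (1 - q)⁻¹ := by
    rw [hSdef, Finset.sum_mul]
    refine Finset.sum_le_sum fun n _ => ?_
    rw [← Finset.mul_sum]
    exact mul_le_mul_of_nonneg_left (sum_ite_pow_sub_le hq0 hq1 F n) (hφ n)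
  have hSS : S ≤ S ^ 2 := by nlinarith
  have hinv : 0 ≤ (1 - q)⁻¹ := inv_nonneg.2 (by linarith)
  refine (Finset.sum_le_sum fun m hm => Finset.sum_le_sum fun n hn => hpair m hm n hn).trans ?_
  simp only [← Finset.mul_sum, Finset.sum_add_distrib]
  have hprod : ∑ m ∈ F, ∑ n ∈ F, φ m * φ n / r = S ^ 2 / r := by
    simp only [hSdef, sq, Finset.sum_mul_sum, Finset.sum_div]
  have hcomm : ∑ m ∈ F, ∑ n ∈ F, φ n * k n m = ∑ n ∈ F, ∑ m ∈ F, φ n * k n m :=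
    Finset.sum_comm
  simp only [← Finset.mul_sum] at hcomm hrow
  rw [hprod, hcomm, mul_assoc]
  refine mul_le_mul_of_nonneg_left ?_ (by positivity)
  have := mul_le_mul_of_nonneg_right hSS hinv
  have : (1 / r + 4 * (1 - q)⁻¹) * S ^ 2 = S ^ 2 / r + 4 * (S ^ 2 * (1 - q)⁻¹) := by ring
  linarith

/-- The dilated thickenings cover a proportion of every ball that is bounded below. -/
theorem exists_le_volume_real_biUnion (hr : 0 < r) (hR : 0 < R)
    (hpack : ∀ y ∈ Y, ∀ y' ∈ Y, y ≠ y' → 2 * r ≤ |y - y'|)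
    (hcov : ∀ x : ℝ, ∃ y ∈ Y, |x - y| ≤ R) (hφ : ∀ n, 0 ≤ φ n) (hφr : ∀ n, φ n ≤ r)
    (hdiv : ¬ Summable φ) (hα : 1 < |α|) :
    ∃ c > 0, ∀ (x : ℝ) {ρ : ℝ}, 0 < ρ → ∀ M : ℕ, c * ρ ≤
      volume.real ((⋃ n ≥ M, (α ^ n * ·) ⁻¹' Metric.thickening (φ n) Y) ∩
        Metric.closedBall x ρ) := by
  have hα0 : α ≠ 0 := by
    rintro rfl
    norm_num at hα
  have hinv : 0 < (1 - |α|⁻¹)⁻¹ := by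
    have : |α|⁻¹ < 1 := inv_lt_one_of_one_lt₀ hα
    exact inv_pos.2 (by linarith)
  set C := 4 / r * (1 / r + 4 * (1 - |α|⁻¹)⁻¹) with hC
  have hC0 : 0 < C := by positivity
  refine ⟨1 / (R ^ 2 * C), by positivity, fun x ρ hρ M => ?_⟩
  obtain ⟨M₁, hM₁⟩ := pow_unbounded_of_one_lt (2 * (R + r) / ρ) hα
  obtain ⟨N, hS⟩ := exists_one_le_sum_Ico hφ hdiv (max M M₁)
  set F := Finset.Ico (max M M₁) N with hFdef
  set S := ∑ n ∈ F, φ n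
  have hF : ∀ n ∈ F, 2 * (R + r) ≤ |α ^ n| * ρ := by
    intro n hn
    have hn' : M₁ ≤ n := (le_max_right _ _).trans (Finset.mem_Ico.1 hn).1
    rw [← div_le_iff₀ hρ, abs_pow]
    exact hM₁.le.trans (pow_le_pow_right₀ hα.le hn')
  set A : ℕ → Set ℝ := fun n => (α ^ n * ·) ⁻¹' Metric.thickening (φ n) Y
  have hA : ∀ n, MeasurableSet (A n) := fun n =>
    (Metric.isOpen_thickening.preimage (continuous_const_mul (α ^ n))).measurableSet
  have : IsFiniteMeasure (volume.restrict (Metric.closedBall x ρ)) :=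
    ⟨by
      rw [Measure.restrict_apply_univ]
      exact measure_closedBall_lt_top⟩
  have ht : 0 < 1 / (R * C * S) := by positivity
  have hmain := sum_measureReal_le_of_pairwise_inter
    (volume.restrict (Metric.closedBall x ρ)) F A hA ht
  simp only [measureReal_restrict_apply (hA _),
    measureReal_restrict_apply ((hA _).inter (hA _)),
    measureReal_restrict_apply (F.measurableSet_biUnion fun i _ => hA i)] at hmain
  have hlow : S * ρ / R ≤ ∑ n ∈ F, volume.real (A n ∩ Metric.closedBall x ρ) := by
    rw [Finset.sum_mul, Finset.sum_div]
    exact Finset.sum_le_sum fun n hn => le_volume_real_preimage_thickening hr hR hpack hcov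
      (hφ n) (hφr n) (pow_ne_zero n hα0) x (hF n hn)
  have hup := sum_sum_volume_real_inter_le hr hpack hφ hφr hα x hρ.le (F := F)
    (fun n hn => by linarith [hF n hn]) hS
  have hmono : volume.real ((⋃ n ∈ F, A n) ∩ Metric.closedBall x ρ) ≤
      volume.real ((⋃ n ≥ M, A n) ∩ Metric.closedBall x ρ) := by
    refine measureReal_mono (inter_subset_inter_left _ ?_)
      ((measure_mono inter_subset_right).trans_lt measure_closedBall_lt_top).ne
    exact biUnion_subset_biUnion_left fun n hn =>
      (le_max_left M M₁).trans (Finset.mem_Ico.1 hn).1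
  refine le_trans ?_ hmono
  set V := volume.real ((⋃ n ∈ F, A n) ∩ Metric.closedBall x ρ)
  have h1 := hlow.trans (hmain.trans (add_le_add_left
    (mul_le_mul_of_nonneg_left hup (by positivity)) _))
  have h2 : 1 / (R * C * S) / 2 * (4 * ρ / r * (1 / r + 4 * (1 - |α|⁻¹)⁻¹) * S ^ 2) =
      S * ρ / R / 2 := by
    have : 4 * ρ / r * (1 / r + 4 * (1 - |α|⁻¹)⁻¹) = C * ρ := by
      rw [hC]
      ring
    rw [this]
    field_simp
  have h3 : 1 / (2 * (1 / (R * C * S))) * V = R * C * S / 2 * V := by field_simp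
  rw [h2, h3] at h1
  have h4 : S * (ρ / R) ≤ S * (R * C * V) := by
    have : S * ρ / R = S * (ρ / R) := by ring
    linarith
  have h5 := le_of_mul_le_mul_left h4 (by linarith)
  rw [div_mul_eq_mul_div, one_mul, div_le_iff₀ (by positivity)]
  rw [div_le_iff₀ hR] at h5
  linarith

end Dilations

/-- A measurable set filling a fixed proportion of every small ball has full measure. -/
theorem ae_mem_of_le_volume_real_inter_closedBall {U : Set ℝ} (hU : MeasurableSet U) {c : ℝ}
    (hc : 0 < c)
    (h : ∀ (x : ℝ) {ρ : ℝ}, 0 < ρ → c * ρ ≤ volume.real (U ∩ Metric.closedBall x ρ)) :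
    ∀ᵐ x : ℝ, x ∈ U := by
  have hd := Besicovitch.ae_tendsto_measure_inter_div (volume : Measure ℝ) Uᶜ
  rw [ae_iff]
  change volume Uᶜ = 0
  rw [← Measure.restrict_eq_zero, ← ae_eq_bot, ← Filter.eventually_false_iff_eq_bot]
  filter_upwards [hd] with x hx
  have hreal := (ENNReal.tendsto_toReal ENNReal.one_ne_top).comp hx
  have hlt : 1 - c / 2 < (1 : ENNReal).toReal := by
    rw [ENNReal.toReal_one]
    linarith
  obtain ⟨ρ, hρ, hρ0⟩ := ((hreal.eventually (lt_mem_nhds hlt)).and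
    (self_mem_nhdsWithin (a := (0 : ℝ)) (s := Ioi 0))).exists
  simp only [Function.comp_apply, ENNReal.toReal_div, ← measureReal_def] at hρ
  rw [Real.volume_real_closedBall hρ0.le, lt_div_iff₀ (by positivity)] at hρ
  have hsum := measureReal_inter_add_sdiff (μ := volume) (s := Metric.closedBall x ρ) hU
    measure_closedBall_lt_top.ne
  rw [Real.volume_real_closedBall hρ0.le, sdiff_eq, inter_comm, inter_comm _ Uᶜ] at hsum
  have := h x hρ0
  nlinarith

/-- Divergence half of the main theorem: if `Y` is a Delone set in `ℝ` with packing
radius `r` and covering radius `R`, `ψ : ℕ → [0,∞)` and `|α| > 1` with `∑ ψ(n) = ∞`,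
then for almost every `x` there are infinitely many pairs `(n, y) ∈ ℕ × Y` with
`|α^n x - y| ≤ ψ n`. -/
theorem delone_khintchine_divergence
    (Y : Set ℝ) (r R : ℝ) (hr : 0 < r) (hR : 0 < R)
    (hpack : ∀ y ∈ Y, ∀ y' ∈ Y, y ≠ y' → 2 * r ≤ |y - y'|)
    (hcov : ∀ x : ℝ, ∃ y ∈ Y, |x - y| ≤ R)
    (ψ : ℕ → ℝ) (hψ : ∀ n, 0 ≤ ψ n)
    (α : ℝ) (hα : 1 < |α|)
    (hdiv : ¬ Summable ψ) :
    ∀ᵐ x : ℝ, {p : ℕ × ℝ | p.2 ∈ Y ∧ |α ^ p.1 * x - p.2| ≤ ψ p.1}.Infinite := by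
  obtain ⟨c, hc, hcover⟩ := exists_le_volume_real_biUnion (φ := fun n => min (ψ n) r) hr hR
    hpack hcov (fun n => le_min (hψ n) hr.le) (fun n => min_le_right _ _)
    (not_summable_min hdiv hr) hα
  have hall : ∀ᵐ x : ℝ, ∀ M : ℕ,
      x ∈ ⋃ n ≥ M, (α ^ n * ·) ⁻¹' Metric.thickening (min (ψ n) r) Y := by
    refine ae_all_iff.2 fun M => ae_mem_of_le_volume_real_inter_closedBall ?_ hc
      fun x ρ hρ => hcover x hρ M
    exact (isOpen_biUnion fun n _ =>
      Metric.isOpen_thickening.preimage (continuous_const_mul (α ^ n))).measurableSet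
  filter_upwards [hall] with x hx
  refine Set.Infinite.of_image Prod.fst (Set.infinite_of_forall_exists_gt fun M => ?_)
  obtain ⟨n, hn, hxn⟩ := mem_iUnion₂.1 (hx (M + 1))
  obtain ⟨y, hy, hd⟩ := Metric.mem_thickening_iff.1 hxn
  refine ⟨n, ⟨(n, y), ⟨hy, ?_⟩, rfl⟩, by lia⟩
  rw [Real.dist_eq] at hd
  exact hd.le.trans (min_le_left _ _)
end

section
/- Let Y be a Delone set in ℝ with packing radius r > 0 and covering radius R > 0, let 0 ≤ a < b, and let α > 1 be real. Let ψ : ℕ → [0,∞) and for each n ∈ ℕ define 𝒜_n = {x ∈ [a,b) : |α^n x − y| ≤ ψ(n) for some y ∈ Y}. Then there exists a universal constant C > 0 and an N ∈ ℕ (depending on a, b) such that for all n ≥ N, λ(𝒜_n) ≤ C (b−a) ψ(n)/r. -/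
open MeasureTheory Set

/-- The preimage of a closed ball of radius `ε` under multiplication by `t > 0` has measure
at most `2 * ε / t`. -/
lemma volume_abs_mul_sub_le {t : ℝ} (ht : 0 < t) (y ε : ℝ) :
    volume {x : ℝ | |t * x - y| ≤ ε} ≤ ENNReal.ofReal (2 * ε / t) := by
  have hsub : {x : ℝ | |t * x - y| ≤ ε} ⊆ Icc ((y - ε) / t) ((y + ε) / t) := by
    intro x (hx : |t * x - y| ≤ ε)
    obtain ⟨h₁, h₂⟩ := abs_le.mp hx
    rw [mem_Icc, div_le_iff₀ ht, le_div_iff₀ ht]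
    constructor <;> linarith
  refine (measure_mono hsub).trans (le_of_eq ?_)
  rw [Real.volume_Icc]
  congr 1
  ring

/-- If the points of `Y` are `δ`-separated, the `x` for which `t * x` is `ε`-close to a point
of `Y ∩ [c, d]` form a set of measure at most `((d - c) / δ + 1) * (2 * ε / t)`. -/
lemma volume_near_separated_le {Y : Set ℝ} {δ t c d ε : ℝ} (hδ : 0 < δ) (ht : 0 < t)
    (hε : 0 ≤ ε) (hcd : c ≤ d) (hY : ∀ y ∈ Y, ∀ y' ∈ Y, y ≠ y' → δ ≤ |y - y'|) :
    volume {x | ∃ y ∈ Y ∩ Icc c d, |t * x - y| ≤ ε}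
      ≤ ENNReal.ofReal (((d - c) / δ + 1) * (2 * ε / t)) := by
  set S : ℕ → Set ℝ := fun k =>
    {x | ∃ y ∈ Y ∩ Icc c d, ⌊(y - c) / δ⌋₊ = k ∧ |t * x - y| ≤ ε}
  have hcell : ∀ k, volume (S k) ≤ ENNReal.ofReal (2 * ε / t) := by
    intro k
    rcases (S k).eq_empty_or_nonempty with h | ⟨_, y, ⟨hyY, hy⟩, hyk, -⟩
    · simp [h]
    · refine (measure_mono ?_).trans (volume_abs_mul_sub_le ht y ε)
      rintro x ⟨z, ⟨hzY, hz⟩, hzk, hx⟩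
      suffices z = y by rwa [this] at hx
      by_contra hne
      have hsep := hY z hzY y hyY hne
      obtain ⟨hy₁, hy₂⟩ :=
        (Nat.floor_eq_iff (div_nonneg (sub_nonneg.mpr hy.1) hδ.le)).mp hyk
      obtain ⟨hz₁, hz₂⟩ :=
        (Nat.floor_eq_iff (div_nonneg (sub_nonneg.mpr hz.1) hδ.le)).mp hzk
      rw [le_div_iff₀ hδ] at hy₁ hz₁
      rw [div_lt_iff₀ hδ] at hy₂ hz₂
      have : |z - y| < δ := abs_lt.mpr ⟨by linarith, by linarith⟩
      linarith
  set K : ℕ := ⌊(d - c) / δ⌋₊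
  have hcover : {x | ∃ y ∈ Y ∩ Icc c d, |t * x - y| ≤ ε} ⊆ ⋃ k ∈ Finset.range (K + 1), S k := by
    rintro x ⟨y, hy, hx⟩
    refine mem_biUnion (x := ⌊(y - c) / δ⌋₊) ?_ ⟨y, hy, rfl, hx⟩
    simp only [Finset.coe_range, mem_Iio, Nat.lt_succ_iff]
    have := hy.2.2
    exact Nat.floor_le_floor (by gcongr)
  calc volume {x | ∃ y ∈ Y ∩ Icc c d, |t * x - y| ≤ ε}
      ≤ ∑ k ∈ Finset.range (K + 1), volume (S k) :=
        (measure_mono hcover).trans (measure_biUnion_finset_le _ _)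
    _ ≤ ∑ _k ∈ Finset.range (K + 1), ENNReal.ofReal (2 * ε / t) :=
        Finset.sum_le_sum fun k _ => hcell k
    _ = ENNReal.ofReal (((K + 1 : ℕ) : ℝ) * (2 * ε / t)) := by
        rw [Finset.sum_const, Finset.card_range, nsmul_eq_mul,
          ENNReal.ofReal_mul (Nat.cast_nonneg _), ENNReal.ofReal_natCast]
    _ ≤ ENNReal.ofReal (((d - c) / δ + 1) * (2 * ε / t)) := by
        have hK : (K : ℝ) ≤ (d - c) / δ :=
          Nat.floor_le (div_nonneg (sub_nonneg.mpr hcd) hδ.le)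
        push_cast
        gcongr

/-- There is a universal constant `C > 0` such that for any Delone set `Y` with packing
radius `r` and covering radius `R`, any `0 ≤ a < b`, `α > 1` and `ψ : ℕ → [0,∞)`, for all
sufficiently large `n` (depending on `a, b`) the set
`𝒜_n = {x ∈ [a,b) : ∃ y ∈ Y, |α^n x - y| ≤ ψ n}` has measure at most `C (b-a) ψ(n)/r`. -/
theorem measure_approx_set_upper_bound :
    ∃ C : ℝ, 0 < C ∧
      ∀ (Y : Set ℝ) (r R : ℝ), 0 < r → 0 < R →
        (∀ y ∈ Y, ∀ y' ∈ Y, y ≠ y' → 2 * r ≤ |y - y'|) →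
        (∀ x : ℝ, ∃ y ∈ Y, |x - y| ≤ R) →
        ∀ (a b : ℝ), 0 ≤ a → a < b →
        ∀ (α : ℝ), 1 < α →
        ∀ (ψ : ℕ → ℝ), (∀ n, 0 ≤ ψ n) →
        ∃ N : ℕ, ∀ n ≥ N,
          volume {x | x ∈ Ico a b ∧ ∃ y ∈ Y, |α ^ n * x - y| ≤ ψ n}
            ≤ ENNReal.ofReal (C * (b - a) * ψ n / r) := by
  refine ⟨5, by norm_num, ?_⟩
  intro Y r R hr _ hsep _ a b _ hab α hα ψ hψ
  have hba : 0 < b - a := sub_pos.mpr hab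
  obtain ⟨N, hN⟩ := pow_unbounded_of_one_lt (r / (b - a)) hα
  refine ⟨N, fun n hn => ?_⟩
  have ht : 0 < α ^ n := by positivity
  have hlarge : r ≤ α ^ n * (b - a) := by
    rw [← div_le_iff₀ hba]
    exact hN.le.trans (pow_le_pow_right₀ hα.le hn)
  rcases le_or_gt r (ψ n) with hψr | hψr
  · calc volume {x | x ∈ Ico a b ∧ ∃ y ∈ Y, |α ^ n * x - y| ≤ ψ n}
        ≤ volume (Ico a b) := measure_mono fun x hx => hx.1
      _ = ENNReal.ofReal (b - a) := Real.volume_Ico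
      _ ≤ ENNReal.ofReal (5 * (b - a) * ψ n / r) := by
        refine ENNReal.ofReal_le_ofReal ?_
        rw [le_div_iff₀ hr]
        nlinarith [mul_le_mul_of_nonneg_left hψr hba.le, mul_nonneg hba.le (hψ n)]
  · have hsub : {x | x ∈ Ico a b ∧ ∃ y ∈ Y, |α ^ n * x - y| ≤ ψ n} ⊆
        {x | ∃ y ∈ Y ∩ Icc (α ^ n * a - r) (α ^ n * b + r), |α ^ n * x - y| ≤ ψ n} := by
      rintro x ⟨⟨hax, hxb⟩, y, hy, hxy⟩
      have h₁ := mul_le_mul_of_nonneg_left hax ht.le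
      have h₂ := mul_le_mul_of_nonneg_left hxb.le ht.le
      obtain ⟨h₃, h₄⟩ := abs_le.mp hxy
      exact ⟨y, ⟨hy, by linarith, by linarith⟩, hxy⟩
    have hle := mul_le_mul_of_nonneg_left hab.le ht.le
    refine (measure_mono hsub).trans <|
      (volume_near_separated_le (by positivity : 0 < 2 * r) ht (hψ n) (by linarith) hsep).trans ?_
    refine ENNReal.ofReal_le_ofReal ?_
    have hcount : (α ^ n * b + r - (α ^ n * a - r)) / (2 * r) + 1 ≤
        5 * (α ^ n * (b - a)) / (2 * r) := by
      rw [div_add_one (by positivity), div_le_div_iff_of_pos_right (by positivity)]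
      linarith
    calc ((α ^ n * b + r - (α ^ n * a - r)) / (2 * r) + 1) * (2 * ψ n / α ^ n)
        ≤ 5 * (α ^ n * (b - a)) / (2 * r) * (2 * ψ n / α ^ n) :=
          mul_le_mul_of_nonneg_right hcount (div_nonneg (by linarith [hψ n]) ht.le)
      _ = 5 * (b - a) * ψ n / r := by
          field_simp
end
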